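/- Let Φ be an irreducible root system of rank at least 3, different from B_ℓ, C_ℓ, and G₂. Let α, β, γ ∈ Φ be roots of equal length with α = β + γ. Then there exist roots β₁, γ₁ ∈ Φ∖(ℤβ + ℤγ) of the same length as β with β₁ + γ₁ = β; moreover, the roots β, γ, β₁, γ₁ are contained in a root subsystem Φ₀ ⊆ Φ of type A₃ or C₃. -/

import Mathlib

open CategoryTheory

noncomputable section
namespace Paper

/-! ### A. Root systems -/

open RealInnerProductSpace

variable {V : Type} [NormedAddCommGroup V] [InnerProductSpace ℝ V]

/-- The Cartan number `⟨β, α⟩ = 2(β,α)/(α,α)`. -/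
def cartan (β α : V) : ℝ := 2 * ⟪β, α⟫ / ⟪α, α⟫

/-- A (reduced, crystallographic) root system in a Euclidean space `V`. -/
structure IsRootSystem (Φ : Set V) : Prop where
  finite : Φ.Finite
  nonzero : (0 : V) ∉ Φ
  neg_mem : ∀ α ∈ Φ, -α ∈ Φ
  reduced : ∀ α ∈ Φ, ∀ c : ℝ, c • α ∈ Φ → c = 1 ∨ c = -1
  reflect_mem : ∀ α ∈ Φ, ∀ β ∈ Φ, β - cartan β α • α ∈ Φ
  cartan_int : ∀ α ∈ Φ, ∀ β ∈ Φ, ∃ n : ℤ, cartan β α = (n : ℝ)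

/-- Irreducibility: no decomposition into two nonempty mutually orthogonal parts. -/
def IsIrreducible (Φ : Set V) : Prop :=
  Φ.Nonempty ∧ ∀ Φ₁ Φ₂ : Set V, Φ = Φ₁ ∪ Φ₂ →
    (∀ α ∈ Φ₁, ∀ β ∈ Φ₂, ⟪α, β⟫ = 0) → Φ₁ = ∅ ∨ Φ₂ = ∅

/-- The rank of a root system is the dimension of its span. -/
def rank (Φ : Set V) : ℕ := Module.finrank ℝ (Submodule.span ℝ Φ)

/-- standard basis vector of `ℝ^ℓ`. -/
def esb (ℓ : ℕ) (i : Fin ℓ) : EuclideanSpace ℝ (Fin ℓ) := EuclideanSpace.single i (1:ℝ)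

/-- The standard root system of type `Aₙ` (in `ℝ^{n+1}`). -/
def stdA (n : ℕ) : Set (EuclideanSpace ℝ (Fin (n+1))) :=
  {v | ∃ i j, i ≠ j ∧ v = esb (n+1) i - esb (n+1) j}

/-- The standard root system of type `B_ℓ`. -/
def stdB (ℓ : ℕ) : Set (EuclideanSpace ℝ (Fin ℓ)) :=
  {v | ∃ i, v = esb ℓ i ∨ v = -esb ℓ i} ∪
  {v | ∃ i j, i ≠ j ∧ (v = esb ℓ i + esb ℓ j ∨ v = -(esb ℓ i + esb ℓ j) ∨ v = esb ℓ i - esb ℓ j)}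

/-- The standard root system of type `C_ℓ`. -/
def stdC (ℓ : ℕ) : Set (EuclideanSpace ℝ (Fin ℓ)) :=
  {v | ∃ i, v = (2:ℝ) • esb ℓ i ∨ v = -((2:ℝ) • esb ℓ i)} ∪
  {v | ∃ i j, i ≠ j ∧ (v = esb ℓ i + esb ℓ j ∨ v = -(esb ℓ i + esb ℓ j) ∨ v = esb ℓ i - esb ℓ j)}

/-- `Φ` is isomorphic (as a root system) to the standard model `Ψ ⊆ ℝ^ℓ`:
there is a linear map, injective on the span of `Ψ`, carrying `Ψ` onto `Φ`
and preserving Cartan numbers. -/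
def SimilarTo {ℓ : ℕ} (Φ : Set V) (Ψ : Set (EuclideanSpace ℝ (Fin ℓ))) : Prop :=
  ∃ f : EuclideanSpace ℝ (Fin ℓ) →ₗ[ℝ] V,
    Set.InjOn f (Submodule.span ℝ Ψ : Submodule ℝ (EuclideanSpace ℝ (Fin ℓ))) ∧
    f '' Ψ = Φ ∧ ∀ α ∈ Ψ, ∀ β ∈ Ψ, cartan (f β) (f α) = cartan β α

/-- `Φ` is of type `B_ℓ` or `C_ℓ` for some `ℓ`. -/
def IsTypeBC (Φ : Set V) : Prop := ∃ ℓ : ℕ, SimilarTo Φ (stdB ℓ) ∨ SimilarTo Φ (stdC ℓ)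

end Paper
namespace Paper

open RealInnerProductSpace

section RootSystem

variable {V : Type} [NormedAddCommGroup V] [InnerProductSpace ℝ V] {Φ : Set V}

lemma IsRootSystem.inner_self_pos (hΦ : IsRootSystem Φ) {x : V} (hx : x ∈ Φ) : 0 < ⟪x, x⟫ :=
  real_inner_self_pos.2 fun h => hΦ.nonzero (h ▸ hx)

lemma IsRootSystem.exists_int (hΦ : IsRootSystem Φ) {x y : V} (hx : x ∈ Φ) (hy : y ∈ Φ) :
    ∃ n : ℤ, 2 * ⟪y, x⟫ = n * ⟪x, x⟫ ∧ y - (n : ℝ) • x ∈ Φ := by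
  obtain ⟨n, hn⟩ := hΦ.cartan_int x hx y hy
  refine ⟨n, ?_, hn ▸ hΦ.reflect_mem x hx y hy⟩
  have := (hΦ.inner_self_pos hx).ne'
  rw [cartan] at hn
  field_simp at hn
  linarith

lemma IsRootSystem.reflect_of_inner (hΦ : IsRootSystem Φ) {x y : V} (hx : x ∈ Φ) (hy : y ∈ Φ)
    {c : ℝ} (h : 2 * ⟪y, x⟫ = c * ⟪x, x⟫) : y - c • x ∈ Φ := by
  have := hΦ.reflect_mem x hx y hy
  rwa [cartan, h, mul_div_cancel_right₀ _ (hΦ.inner_self_pos hx).ne'] at this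

lemma IsRootSystem.add_mem (hΦ : IsRootSystem Φ) {x y : V} (hx : x ∈ Φ) (hy : y ∈ Φ)
    (h : 2 * ⟪y, x⟫ = -⟪x, x⟫) : y + x ∈ Φ := by
  simpa using hΦ.reflect_of_inner hx hy (c := -1) (by linarith)

lemma IsRootSystem.sub_mem (hΦ : IsRootSystem Φ) {x y : V} (hx : x ∈ Φ) (hy : y ∈ Φ)
    (h : 2 * ⟪y, x⟫ = ⟪x, x⟫) : y - x ∈ Φ := by
  simpa using hΦ.reflect_of_inner hx hy (c := 1) (by linarith)

/-- A root outside a plane spanned by two roots which is not orthogonal to that plane. -/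
lemma IsIrreducible.exists_root_notMem_span_pair (hirr : IsIrreducible Φ) (hrank : 3 ≤ rank Φ)
    {β γ : V} (hβ : β ∈ Φ) :
    ∃ δ ∈ Φ, δ ∉ Submodule.span ℝ {β, γ} ∧ (⟪δ, β⟫ ≠ 0 ∨ ⟪δ, γ⟫ ≠ 0) := by
  by_contra! hcon
  set P := Submodule.span ℝ {β, γ}
  have hβP : β ∈ P := Submodule.subset_span (by simp)
  have horth : ∀ x ∈ Φ ∩ P, ∀ y ∈ Φ \ P, ⟪x, y⟫ = 0 := by
    rintro x ⟨-, hx⟩ y ⟨hy, hyP⟩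
    obtain ⟨m, n, rfl⟩ := Submodule.mem_span_pair.1 hx
    obtain ⟨h1, h2⟩ := hcon y hy hyP
    rw [inner_add_left, real_inner_smul_left, real_inner_smul_left, real_inner_comm, h1,
      real_inner_comm, h2, mul_zero, mul_zero, add_zero]
  rcases hirr.2 (Φ ∩ P) (Φ \ P) (Set.inter_union_sdiff Φ P).symm horth with h | h
  · exact Set.notMem_empty β (h ▸ ⟨hβ, hβP⟩)
  · have hle : Submodule.span ℝ Φ ≤ P := Submodule.span_le.2 (Set.sdiff_eq_empty.1 h)
    have h2 : Module.finrank ℝ P ≤ 2 := by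
      classical
      have := finrank_span_finset_le_card (R := ℝ) ({β, γ} : Finset V)
      rw [Finset.coe_pair] at this
      exact this.trans Finset.card_le_two
    have : FiniteDimensional ℝ P := FiniteDimensional.span_of_finite ℝ (by simp)
    have := Submodule.finrank_mono hle
    rw [rank] at hrank
    omega

/-- Two distinct, non-opposite roots of equal length have inner product `0` or `±` half of the
squared length. -/
lemma IsRootSystem.inner_eq_of_same_length (hΦ : IsRootSystem Φ) {k : ℝ} {x y : V}
    (hx : x ∈ Φ) (hy : y ∈ Φ) (hxk : ⟪x, x⟫ = 2 * k) (hyk : ⟪y, y⟫ = 2 * k)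
    (hne : y ≠ x) (hne' : y ≠ -x) :
    ∃ n : ℤ, ⟪y, x⟫ = n * k ∧ -1 ≤ n ∧ n ≤ 1 := by
  have hk := hΦ.inner_self_pos hx
  obtain ⟨n, hn, -⟩ := hΦ.exists_int hx hy
  have h1 : 0 < ⟪y - x, y - x⟫ := real_inner_self_pos.2 (sub_ne_zero.2 hne)
  have h2 : 0 < ⟪y + x, y + x⟫ :=
    real_inner_self_pos.2 fun h => hne' (eq_neg_of_add_eq_zero_left h)
  rw [real_inner_sub_sub_self] at h1
  rw [real_inner_add_add_self] at h2
  rw [hxk] at *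
  have hk' : 0 < k := by linarith
  have hn' : ⟪y, x⟫ = n * k := by linarith
  refine ⟨n, hn', ?_, ?_⟩
  · have : (-2 : ℝ) < n := lt_of_mul_lt_mul_right (by linarith) hk'.le
    have : -2 < n := by exact_mod_cast this
    omega
  · have : (n : ℝ) < 2 := lt_of_mul_lt_mul_right (by linarith) hk'.le
    have : n < 2 := by exact_mod_cast this
    omega

/-- Given roots `β`, `γ` of equal length at angle `120°`, there is a root of the same length
outside of their plane and not orthogonal to it. -/
lemma exists_same_length_root (hΦ : IsRootSystem Φ) (hirr : IsIrreducible Φ) (hrank : 3 ≤ rank Φ)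
    {β γ : V} (hβ : β ∈ Φ) (hγ : γ ∈ Φ) {k : ℝ} (hββ : ⟪β, β⟫ = 2 * k) (hγγ : ⟪γ, γ⟫ = 2 * k)
    (hβγ : ⟪β, γ⟫ = -k) :
    ∃ δ ∈ Φ, δ ∉ Submodule.span ℝ {β, γ} ∧ ⟪δ, δ⟫ = 2 * k ∧ (⟪δ, β⟫ ≠ 0 ∨ ⟪δ, γ⟫ ≠ 0) := by
  obtain ⟨δ, hδ, hδP, hor⟩ := hirr.exists_root_notMem_span_pair hrank (γ := γ) hβ
  have hk : 0 < k := by linarith [hΦ.inner_self_pos hβ]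
  have hN := hΦ.inner_self_pos hδ
  obtain ⟨p, hp, -⟩ := hΦ.exists_int hβ hδ
  obtain ⟨q, hq, -⟩ := hΦ.exists_int hγ hδ
  obtain ⟨r, hr, hrm⟩ := hΦ.exists_int hδ hβ
  obtain ⟨s, hs, hsm⟩ := hΦ.exists_int hδ hγ
  have hβP : β ∈ Submodule.span ℝ {β, γ} := Submodule.subset_span (by simp)
  have hγP : γ ∈ Submodule.span ℝ {β, γ} := Submodule.subset_span (by simp)
  have key : ∀ x ∈ Submodule.span ℝ {β, γ}, ∀ t : ℝ, t ≠ 0 →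
      x - t • δ ∉ Submodule.span ℝ {β, γ} := by
    intro x hx t ht h
    have h' := Submodule.sub_mem _ hx h
    rw [sub_sub_cancel] at h'
    exact hδP ((Submodule.smul_mem_iff _ ht).1 h')
  have hp' : ⟪δ, β⟫ = p * k := by rw [hββ] at hp; linarith
  have hq' : ⟪δ, γ⟫ = q * k := by rw [hγγ] at hq; linarith
  rw [real_inner_comm, hp'] at hr
  rw [real_inner_comm, hq'] at hs
  have norm_reflect : ∀ x : V, ⟪x, x⟫ = 2 * k → ∀ t : ℝ, 2 * ⟪δ, x⟫ = t * ⟪δ, δ⟫ →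
      ⟪x - t • δ, x - t • δ⟫ = 2 * k := by
    intro x hx t ht
    rw [real_inner_sub_sub_self, real_inner_smul_right, real_inner_smul_left,
      real_inner_smul_right, real_inner_comm δ x, hx]
    linear_combination -t * ht
  by_cases hr0 : r = 0
  · subst hr0
    have hp0 : (p : ℝ) = 0 := by
      have : (p : ℝ) * k = 0 := by push_cast at hr; linarith
      exact (mul_eq_zero.1 this).resolve_right hk.ne'
    have hs0 : (s : ℝ) ≠ 0 := by
      intro h
      rw [h] at hs
      rcases hor with h | h
      · exact h (by rw [hp', hp0, zero_mul])
      · exact h (by rw [hq']; linarith)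
    refine ⟨_, hsm, key γ hγP s hs0, norm_reflect γ hγγ s (by rw [hq', hs]), Or.inl ?_⟩
    rw [inner_sub_left, real_inner_smul_left, hp', hp0, real_inner_comm, hβγ]
    simp [hk.ne']
  · have hr0' : (r : ℝ) ≠ 0 := by exact_mod_cast hr0
    refine ⟨_, hrm, key β hβP r hr0', norm_reflect β hββ r (by rw [hp', hr]), ?_⟩
    by_contra! h
    rw [inner_sub_left, inner_sub_left, real_inner_smul_left, real_inner_smul_left, hp', hq',
      hββ, hβγ] at h
    have h1 : (r : ℝ) * p = 2 := mul_right_cancel₀ hk.ne' (by linarith [h.1])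
    have h2 : (r : ℝ) * q = -1 := mul_right_cancel₀ hk.ne' (by linarith [h.2])
    have h3 : (r : ℝ) * q = s * p := by
      refine mul_right_cancel₀ (mul_pos hN hk).ne' ?_
      linear_combination (-q * k) * hr + p * k * hs
    have hrp : r * p = 2 := by exact_mod_cast h1
    have h3' : s * p = -1 := by exact_mod_cast h3.symm.trans h2
    have h2' : r * q = -1 := by exact_mod_cast h2
    rcases Int.isUnit_iff.1 (IsUnit.of_mul_eq_one (-q) (by linarith) : IsUnit r) with h | h <;>
      rcases Int.isUnit_iff.1 (IsUnit.of_mul_eq_one (-s) (by linarith) : IsUnit p) with h' | h' <;>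
      simp [h, h'] at hrp

/-- A root of the same length as `β`, `γ` outside of their plane, at angle `60°` to `β` and
orthogonal to `γ`. -/
lemma exists_adjacent_root (hΦ : IsRootSystem Φ) (hirr : IsIrreducible Φ) (hrank : 3 ≤ rank Φ)
    {β γ : V} (hβ : β ∈ Φ) (hγ : γ ∈ Φ) (hα : β + γ ∈ Φ) {k : ℝ} (hββ : ⟪β, β⟫ = 2 * k)
    (hγγ : ⟪γ, γ⟫ = 2 * k) (hβγ : ⟪β, γ⟫ = -k) :
    ∃ a ∈ Φ, a ∉ Submodule.span ℝ {β, γ} ∧ ⟪a, a⟫ = 2 * k ∧ ⟪a, β⟫ = k ∧ ⟪a, γ⟫ = 0 := by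
  obtain ⟨δ, hδ, hδP, hδδ, hor⟩ := exists_same_length_root hΦ hirr hrank hβ hγ hββ hγγ hβγ
  have hβP : β ∈ Submodule.span ℝ {β, γ} := Submodule.subset_span (by simp)
  have hγP : γ ∈ Submodule.span ℝ {β, γ} := Submodule.subset_span (by simp)
  have hαP := Submodule.add_mem _ hβP hγP
  have hγβ : ⟪γ, β⟫ = -k := by rw [real_inner_comm, hβγ]
  have hαα : ⟪β + γ, β + γ⟫ = 2 * k := by
    rw [real_inner_add_add_self]; linarith
  have int_inner : ∀ x ∈ Φ, x ∈ Submodule.span ℝ {β, γ} → ⟪x, x⟫ = 2 * k →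
      ∃ n : ℤ, ⟪δ, x⟫ = n * k ∧ -1 ≤ n ∧ n ≤ 1 := by
    intro x hx hxP hxx
    refine hΦ.inner_eq_of_same_length hx hδ hxx hδδ ?_ ?_
    · rintro rfl; exact hδP hxP
    · rintro rfl; exact hδP (Submodule.neg_mem _ hxP)
  obtain ⟨p, hp, hp1, hp2⟩ := int_inner β hβ hβP hββ
  obtain ⟨q, hq, hq1, hq2⟩ := int_inner γ hγ hγP hγγ
  obtain ⟨t, ht, ht1, ht2⟩ := int_inner _ hα hαP hαα
  have hk : 0 < k := by linarith [hΦ.inner_self_pos hβ]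
  have htpq : t = p + q := by
    rw [inner_add_right, hp, hq] at ht
    have : (t : ℝ) = p + q := mul_right_cancel₀ hk.ne' (by linarith)
    exact_mod_cast this
  have hne : p ≠ 0 ∨ q ≠ 0 := by
    by_contra! h
    simp [hp, hq, h.1, h.2] at hor
  have sub_notMem : ∀ x ∈ Submodule.span ℝ {β, γ}, x - δ ∉ Submodule.span ℝ {β, γ} := by
    intro x hx h
    exact hδP (by simpa using Submodule.sub_mem _ hx h)
  have add_notMem : ∀ x ∈ Submodule.span ℝ {β, γ}, x + δ ∉ Submodule.span ℝ {β, γ} := by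
    intro x hx h
    exact hδP (by simpa using Submodule.sub_mem _ h hx)
  have hβδ : ⟪β, δ⟫ = p * k := by rw [real_inner_comm, hp]
  have hγδ : ⟪γ, δ⟫ = q * k := by rw [real_inner_comm, hq]
  have hcases : (p = 1 ∧ q = 0) ∨ (p = -1 ∧ q = 0) ∨ (p = 1 ∧ q = -1) ∨ (p = -1 ∧ q = 1) ∨
      (p = 0 ∧ q = 1) ∨ (p = 0 ∧ q = -1) := by omega
  rcases hcases with ⟨rfl, rfl⟩ | ⟨rfl, rfl⟩ | ⟨rfl, rfl⟩ | ⟨rfl, rfl⟩ | ⟨rfl, rfl⟩ | ⟨rfl, rfl⟩ <;>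
    push_cast at hp hq hβδ hγδ
  · exact ⟨δ, hδ, hδP, hδδ, by linarith, by linarith⟩
  · refine ⟨-δ, hΦ.neg_mem δ hδ, fun h => hδP (by simpa using Submodule.neg_mem _ h), ?_, ?_, ?_⟩
      <;> simp only [inner_neg_left, inner_neg_right] <;> linarith
  · refine ⟨β - δ, hΦ.sub_mem hδ hβ (by linarith), sub_notMem β hβP, ?_, ?_, ?_⟩ <;>
      simp only [inner_sub_left, inner_sub_right] <;> linarith
  · refine ⟨β + δ, hΦ.add_mem hδ hβ (by linarith), add_notMem β hβP, ?_, ?_, ?_⟩ <;>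
      simp only [inner_add_left, inner_add_right] <;> linarith
  · refine ⟨β + γ - δ, hΦ.sub_mem hδ hα (by rw [inner_add_left]; linarith),
      sub_notMem _ hαP, ?_, ?_, ?_⟩ <;>
      simp only [inner_sub_left, inner_sub_right, inner_add_left, inner_add_right] <;> linarith
  · refine ⟨β + γ + δ, hΦ.add_mem hδ hα (by rw [inner_add_left]; linarith),
      add_notMem _ hαP, ?_, ?_, ?_⟩ <;>
      simp only [inner_add_left, inner_add_right] <;> linarith

end RootSystem

section Frame

variable {V : Type} [NormedAddCommGroup V] [InnerProductSpace ℝ V] {Φ : Set V}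

lemma SimilarTo.of_inner_map {ℓ : ℕ} {Ψ : Set (EuclideanSpace ℝ (Fin ℓ))}
    (f : EuclideanSpace ℝ (Fin ℓ) →ₗ[ℝ] V) {k : ℝ} (hk : 0 < k)
    (hf : ∀ x ∈ Submodule.span ℝ Ψ, ∀ y ∈ Submodule.span ℝ Ψ, ⟪f x, f y⟫ = k * ⟪x, y⟫)
    (him : f '' Ψ = Φ) : SimilarTo Φ Ψ := by
  refine ⟨f, ?_, him, ?_⟩
  · intro x hx y hy hxy
    have hd := Submodule.sub_mem _ hx hy
    have h := hf _ hd _ hd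
    rw [map_sub, hxy, sub_self, inner_zero_left] at h
    exact sub_eq_zero.1 (inner_self_eq_zero.1 ((mul_eq_zero.1 h.symm).resolve_left hk.ne'))
  · intro α hα β hβ
    have hα := Submodule.subset_span (R := ℝ) hα
    have hβ := Submodule.subset_span (R := ℝ) hβ
    have hk0 := hk.ne'
    rw [cartan, cartan, hf _ hβ _ hα, hf _ hα _ hα, mul_left_comm, mul_div_mul_left _ _ hk0]

/-- An orthogonal triple of vectors of equal squared length `k`. -/
structure IsFrame (k : ℝ) (ε : Fin 3 → V) : Prop where
  pos : 0 < k
  inner_eq : ∀ i j, ⟪ε i, ε j⟫ = if i = j then k else 0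

/-- Integral combinations of the frame vectors with even coordinate sum. -/
def evenLattice (ε : Fin 3 → V) : AddSubgroup V where
  carrier := {v | ∃ x y z : ℤ, Even (x + y + z) ∧
    v = (x : ℝ) • ε 0 + (y : ℝ) • ε 1 + (z : ℝ) • ε 2}
  zero_mem' := ⟨0, 0, 0, by simp, by simp⟩
  add_mem' := by
    rintro _ _ ⟨x, y, z, h, rfl⟩ ⟨x', y', z', h', rfl⟩
    refine ⟨x + x', y + y', z + z', ?_, ?_⟩
    · simpa only [add_add_add_comm] using h.add h'
    · push_cast; module
  neg_mem' := by
    rintro _ ⟨x, y, z, h, rfl⟩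
    refine ⟨-x, -y, -z, ?_, ?_⟩
    · simpa only [neg_add] using h.neg
    · push_cast; module

lemma add_mem_evenLattice (ε : Fin 3 → V) (i j : Fin 3) : ε i + ε j ∈ evenLattice ε := by
  refine ⟨(if i = 0 then 1 else 0) + (if j = 0 then 1 else 0),
    (if i = 1 then 1 else 0) + (if j = 1 then 1 else 0),
    (if i = 2 then 1 else 0) + (if j = 2 then 1 else 0), ?_, ?_⟩ <;>
  fin_cases i <;> fin_cases j <;> first | decide | (simp; try module)

lemma two_smul_mem_evenLattice (ε : Fin 3 → V) (i : Fin 3) : (2 : ℝ) • ε i ∈ evenLattice ε := by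
  rw [two_smul]; exact add_mem_evenLattice ε i i

lemma sub_mem_evenLattice (ε : Fin 3 → V) (i j : Fin 3) : ε i - ε j ∈ evenLattice ε := by
  have := AddSubgroup.sub_mem _ (add_mem_evenLattice ε i j) (two_smul_mem_evenLattice ε j)
  convert this using 1
  module

lemma IsFrame.inner_sum {k : ℝ} {ε : Fin 3 → V} (hε : IsFrame k ε) (a b c a' b' c' : ℝ) :
    ⟪a • ε 0 + b • ε 1 + c • ε 2, a' • ε 0 + b' • ε 1 + c' • ε 2⟫ =
      k * (a * a' + b * b' + c * c') := by
  simp only [inner_add_left, inner_add_right, real_inner_smul_left, real_inner_smul_right,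
    hε.inner_eq]
  simp
  ring

lemma bounds_of_sq_sum_dvd {x y z : ℤ} (h1 : x ^ 2 + y ^ 2 + z ^ 2 ∣ 2 * (x + y))
    (h2 : x ^ 2 + y ^ 2 + z ^ 2 ∣ 2 * (x - y)) : x ∈ Finset.Icc (-4 : ℤ) 4 := by
  have h : x ^ 2 + y ^ 2 + z ^ 2 ∣ 4 * x := by
    have := dvd_add h1 h2
    ring_nf at this ⊢
    exact this
  rw [Finset.mem_Icc]
  by_cases hx : x = 0
  · simp [hx]
  have hle := Int.le_of_dvd (by positivity) ((dvd_abs _ _).2 h)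
  have hsq : |x| ^ 2 ≤ 4 * |x| := by
    rw [abs_mul] at hle
    rw [sq_abs]
    norm_num at hle
    nlinarith [sq_nonneg y, sq_nonneg z]
  have := abs_pos.2 hx
  exact abs_le.1 (by nlinarith)

set_option maxRecDepth 10000 in
lemma coords_of_sq_sum_dvd_of_bounds : ∀ x ∈ Finset.Icc (-4 : ℤ) 4, ∀ y ∈ Finset.Icc (-4 : ℤ) 4,
    ∀ z ∈ Finset.Icc (-4 : ℤ) 4, (x + y + z) % 2 = 0 → x ^ 2 + y ^ 2 + z ^ 2 ≠ 0 →
    x ^ 2 + y ^ 2 + z ^ 2 ∣ 2 * (x + y) → x ^ 2 + y ^ 2 + z ^ 2 ∣ 2 * (x - y) →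
    x ^ 2 + y ^ 2 + z ^ 2 ∣ 2 * (x + z) → x ^ 2 + y ^ 2 + z ^ 2 ∣ 2 * (x - z) →
    x ^ 2 + y ^ 2 + z ^ 2 ∣ 2 * (y + z) → x ^ 2 + y ^ 2 + z ^ 2 ∣ 2 * (y - z) →
    (z = 0 ∧ (x = 1 ∨ x = -1) ∧ (y = 1 ∨ y = -1)) ∨
    (y = 0 ∧ (x = 1 ∨ x = -1) ∧ (z = 1 ∨ z = -1)) ∨
    (x = 0 ∧ (y = 1 ∨ y = -1) ∧ (z = 1 ∨ z = -1)) ∨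
    ((x = 2 ∨ x = -2) ∧ y = 0 ∧ z = 0) ∨ ((y = 2 ∨ y = -2) ∧ x = 0 ∧ z = 0) ∨
    ((z = 2 ∨ z = -2) ∧ x = 0 ∧ y = 0) := by
  decide

/-- `Φ` contains all vectors `ε i ± ε j`, `i ≠ j`. -/
def HasShort (Φ : Set V) (ε : Fin 3 → V) : Prop :=
  ∀ i j, i ≠ j → ε i + ε j ∈ Φ ∧ ε i - ε j ∈ Φ

/-- The vectors `±ε i ± ε j`, `i ≠ j`. -/
def shortVectors (ε : Fin 3 → V) : Set V :=
  {v | ∃ i j, i ≠ j ∧ (v = ε i + ε j ∨ v = -(ε i + ε j) ∨ v = ε i - ε j)}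

/-- The vectors `±2 ε i`. -/
def longVectors (ε : Fin 3 → V) : Set V :=
  {v | ∃ i, v = (2 : ℝ) • ε i ∨ v = -((2 : ℝ) • ε i)}

lemma HasShort.shortVectors_subset (hΦ : IsRootSystem Φ) {ε : Fin 3 → V} (hS : HasShort Φ ε) :
    shortVectors ε ⊆ Φ ∩ evenLattice ε := by
  rintro _ ⟨i, j, hij, rfl | rfl | rfl⟩
  · exact ⟨(hS i j hij).1, add_mem_evenLattice ε i j⟩
  · exact ⟨hΦ.neg_mem _ (hS i j hij).1, neg_mem (add_mem_evenLattice ε i j)⟩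
  · exact ⟨(hS i j hij).2, sub_mem_evenLattice ε i j⟩

lemma IsRootSystem.inter_evenLattice_subset (hΦ : IsRootSystem Φ) {k : ℝ} {ε : Fin 3 → V}
    (hε : IsFrame k ε) (hS : HasShort Φ ε) :
    Φ ∩ evenLattice ε ⊆ longVectors ε ∪ shortVectors ε := by
  rintro η ⟨hη, x, y, z, heven, rfl⟩
  have hk := hε.pos.ne'
  have dvd_of : ∀ a b c : ℤ, (a : ℝ) • ε 0 + (b : ℝ) • ε 1 + (c : ℝ) • ε 2 ∈ Φ →
      x ^ 2 + y ^ 2 + z ^ 2 ∣ 2 * (x * a + y * b + z * c) := by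
    intro a b c h
    obtain ⟨n, hn, -⟩ := hΦ.exists_int hη h
    rw [hε.inner_sum, hε.inner_sum] at hn
    refine ⟨n, ?_⟩
    have : (2 : ℝ) * (x * a + y * b + z * c) = (x ^ 2 + y ^ 2 + z ^ 2) * n :=
      mul_left_cancel₀ hk (by linear_combination hn)
    exact_mod_cast this
  have h01 := hS 0 1 (by decide)
  have h02 := hS 0 2 (by decide)
  have h12 := hS 1 2 (by decide)
  have d1 := dvd_of 1 1 0 (by convert h01.1 using 1; push_cast; module)
  have d2 := dvd_of 1 (-1) 0 (by convert h01.2 using 1; push_cast; module)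
  have d3 := dvd_of 1 0 1 (by convert h02.1 using 1; push_cast; module)
  have d4 := dvd_of 1 0 (-1) (by convert h02.2 using 1; push_cast; module)
  have d5 := dvd_of 0 1 1 (by convert h12.1 using 1; push_cast; module)
  have d6 := dvd_of 0 1 (-1) (by convert h12.2 using 1; push_cast; module)
  simp only [mul_one, mul_zero, add_zero, zero_add, mul_neg, ← sub_eq_add_neg] at d1 d2 d3 d4 d5 d6
  have hN : x ^ 2 + y ^ 2 + z ^ 2 ≠ 0 := by
    intro h
    have hpos := hΦ.inner_self_pos hη
    rw [hε.inner_sum] at hpos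
    have : (x * x + y * y + z * z : ℝ) = 0 := by
      rw [← sq, ← sq, ← sq]; exact_mod_cast h
    simp [this] at hpos
  have bx := bounds_of_sq_sum_dvd d1 d2
  have bY := bounds_of_sq_sum_dvd (x := y) (y := z) (z := x)
    (by convert d5 using 1; ring) (by convert d6 using 1; ring)
  have bz := bounds_of_sq_sum_dvd (x := z) (y := y) (z := x)
    (by convert d5 using 1 <;> ring)
    (by
      rw [show z ^ 2 + y ^ 2 + x ^ 2 = x ^ 2 + y ^ 2 + z ^ 2 by ring,
        show 2 * (z - y) = -(2 * (y - z)) by ring]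
      exact d6.neg_right)
  rcases coords_of_sq_sum_dvd_of_bounds x bx y bY z bz (Int.even_iff.1 heven) hN d1 d2 d3 d4 d5 d6
    with ⟨rfl, rfl | rfl, rfl | rfl⟩ | ⟨rfl, rfl | rfl, rfl | rfl⟩ | ⟨rfl, rfl | rfl, rfl | rfl⟩ |
      ⟨rfl | rfl, rfl, rfl⟩ | ⟨rfl | rfl, rfl, rfl⟩ | ⟨rfl | rfl, rfl, rfl⟩
  · exact Or.inr ⟨0, 1, by decide, Or.inl (by push_cast; module)⟩
  · exact Or.inr ⟨0, 1, by decide, Or.inr (Or.inr (by push_cast; module))⟩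
  · exact Or.inr ⟨1, 0, by decide, Or.inr (Or.inr (by push_cast; module))⟩
  · exact Or.inr ⟨0, 1, by decide, Or.inr (Or.inl (by push_cast; module))⟩
  · exact Or.inr ⟨0, 2, by decide, Or.inl (by push_cast; module)⟩
  · exact Or.inr ⟨0, 2, by decide, Or.inr (Or.inr (by push_cast; module))⟩
  · exact Or.inr ⟨2, 0, by decide, Or.inr (Or.inr (by push_cast; module))⟩
  · exact Or.inr ⟨0, 2, by decide, Or.inr (Or.inl (by push_cast; module))⟩
  · exact Or.inr ⟨1, 2, by decide, Or.inl (by push_cast; module)⟩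
  · exact Or.inr ⟨1, 2, by decide, Or.inr (Or.inr (by push_cast; module))⟩
  · exact Or.inr ⟨2, 1, by decide, Or.inr (Or.inr (by push_cast; module))⟩
  · exact Or.inr ⟨1, 2, by decide, Or.inr (Or.inl (by push_cast; module))⟩
  · exact Or.inl ⟨0, Or.inl (by push_cast; module)⟩
  · exact Or.inl ⟨0, Or.inr (by push_cast; module)⟩
  · exact Or.inl ⟨1, Or.inl (by push_cast; module)⟩
  · exact Or.inl ⟨1, Or.inr (by push_cast; module)⟩
  · exact Or.inl ⟨2, Or.inl (by push_cast; module)⟩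
  · exact Or.inl ⟨2, Or.inr (by push_cast; module)⟩

/-- The linear map sending the standard basis vectors to the vectors `w i`. -/
def esbMap {n : ℕ} (w : Fin n → V) : EuclideanSpace ℝ (Fin n) →ₗ[ℝ] V :=
  Fintype.linearCombination ℝ w ∘ₗ (WithLp.linearEquiv 2 ℝ (Fin n → ℝ)).toLinearMap

lemma esbMap_apply {n : ℕ} (w : Fin n → V) (x : EuclideanSpace ℝ (Fin n)) :
    esbMap w x = ∑ i, x i • w i := rfl

lemma esbMap_esb {n : ℕ} (w : Fin n → V) (i : Fin n) : esbMap w (esb n i) = w i := by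
  simp [esbMap_apply, esb]

lemma similarTo_stdC {k : ℝ} {ε : Fin 3 → V} (hε : IsFrame k ε) :
    SimilarTo (longVectors ε ∪ shortVectors ε) (stdC 3) := by
  refine SimilarTo.of_inner_map (esbMap ε) hε.pos ?_ ?_
  · intro x _ y _
    simp only [esbMap_apply, Fin.sum_univ_three, hε.inner_sum, PiLp.inner_apply,
      RCLike.inner_apply, conj_trivial]
    ring
  · rw [stdC, Set.image_union]
    congr 1
    · ext v
      constructor
      · rintro ⟨_, ⟨i, rfl | rfl⟩, rfl⟩
        · exact ⟨i, Or.inl (by simp [esbMap_esb])⟩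
        · exact ⟨i, Or.inr (by simp [esbMap_esb])⟩
      · rintro ⟨i, rfl | rfl⟩
        · exact ⟨_, ⟨i, Or.inl rfl⟩, by simp [esbMap_esb]⟩
        · exact ⟨_, ⟨i, Or.inr rfl⟩, by simp [esbMap_esb]⟩
    · ext v
      constructor
      · rintro ⟨_, ⟨i, j, hij, rfl | rfl | rfl⟩, rfl⟩
        · exact ⟨i, j, hij, Or.inl (by simp [esbMap_esb])⟩
        · exact ⟨i, j, hij, Or.inr (Or.inl (by simp only [map_neg, map_add, esbMap_esb]))⟩
        · exact ⟨i, j, hij, Or.inr (Or.inr (by simp [esbMap_esb]))⟩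
      · rintro ⟨i, j, hij, rfl | rfl | rfl⟩
        · exact ⟨_, ⟨i, j, hij, Or.inl rfl⟩, by simp [esbMap_esb]⟩
        · exact ⟨_, ⟨i, j, hij, Or.inr (Or.inl rfl)⟩, by simp only [map_neg, map_add, esbMap_esb]⟩
        · exact ⟨_, ⟨i, j, hij, Or.inr (Or.inr rfl)⟩, by simp [esbMap_esb]⟩

/-- Vertices of a tetrahedron whose edges are the vectors `±ε i ± ε j`. -/
def tetrahedron (ε : Fin 3 → V) : Fin 4 → V :=
  ![(1 / 2 : ℝ) • (ε 0 + ε 1 - ε 2), (1 / 2 : ℝ) • (ε 0 - ε 1 + ε 2),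
    (1 / 2 : ℝ) • (-ε 0 + ε 1 + ε 2), (1 / 2 : ℝ) • (-ε 0 - ε 1 - ε 2)]

lemma sum_eq_zero_of_mem_span_stdA {n : ℕ} {x : EuclideanSpace ℝ (Fin (n + 1))}
    (hx : x ∈ Submodule.span ℝ (stdA n)) : ∑ i, x i = 0 := by
  induction hx using Submodule.span_induction with
  | mem x h =>
    obtain ⟨i, j, -, rfl⟩ := h
    simp [esb]
  | zero => simp
  | add x y _ _ hx hy => simp [Finset.sum_add_distrib, hx, hy]
  | smul a x _ hx => simp [← Finset.mul_sum, hx]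

lemma image_esbMap_tetrahedron (ε : Fin 3 → V) :
    esbMap (tetrahedron ε) '' stdA 3 = shortVectors ε := by
  ext v
  constructor
  · rintro ⟨_, ⟨i, j, hij, rfl⟩, rfl⟩
    rw [map_sub, esbMap_esb, esbMap_esb]
    fin_cases i <;> fin_cases j <;> simp [tetrahedron] at hij ⊢
    · exact ⟨1, 2, by decide, Or.inr (Or.inr (by module))⟩
    · exact ⟨0, 2, by decide, Or.inr (Or.inr (by module))⟩
    · exact ⟨0, 1, by decide, Or.inl (by module)⟩
    · exact ⟨2, 1, by decide, Or.inr (Or.inr (by module))⟩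
    · exact ⟨0, 1, by decide, Or.inr (Or.inr (by module))⟩
    · exact ⟨0, 2, by decide, Or.inl (by module)⟩
    · exact ⟨2, 0, by decide, Or.inr (Or.inr (by module))⟩
    · exact ⟨1, 0, by decide, Or.inr (Or.inr (by module))⟩
    · exact ⟨1, 2, by decide, Or.inl (by module)⟩
    · exact ⟨0, 1, by decide, Or.inr (Or.inl (by module))⟩
    · exact ⟨0, 2, by decide, Or.inr (Or.inl (by module))⟩
    · exact ⟨1, 2, by decide, Or.inr (Or.inl (by module))⟩
  · have edge : ∀ i j : Fin 4, i ≠ j →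
        tetrahedron ε i - tetrahedron ε j ∈ esbMap (tetrahedron ε) '' stdA 3 := fun i j hij =>
      ⟨_, ⟨i, j, hij, rfl⟩, by rw [map_sub, esbMap_esb, esbMap_esb]⟩
    have neg_edge : ∀ v ∈ esbMap (tetrahedron ε) '' stdA 3,
        -v ∈ esbMap (tetrahedron ε) '' stdA 3 := by
      rintro _ ⟨_, ⟨i, j, hij, rfl⟩, rfl⟩
      exact ⟨_, ⟨j, i, hij.symm, rfl⟩, by rw [← map_neg, neg_sub]⟩
    have e01 : ε 0 + ε 1 ∈ esbMap (tetrahedron ε) '' stdA 3 := by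
      convert edge 0 3 (by decide) using 1; simp [tetrahedron]; module
    have e02 : ε 0 + ε 2 ∈ esbMap (tetrahedron ε) '' stdA 3 := by
      convert edge 1 3 (by decide) using 1; simp [tetrahedron]; module
    have e12 : ε 1 + ε 2 ∈ esbMap (tetrahedron ε) '' stdA 3 := by
      convert edge 2 3 (by decide) using 1; simp [tetrahedron]; module
    have f01 : ε 0 - ε 1 ∈ esbMap (tetrahedron ε) '' stdA 3 := by
      convert edge 1 2 (by decide) using 1; simp [tetrahedron]; module
    have f02 : ε 0 - ε 2 ∈ esbMap (tetrahedron ε) '' stdA 3 := by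
      convert edge 0 2 (by decide) using 1; simp [tetrahedron]; module
    have f12 : ε 1 - ε 2 ∈ esbMap (tetrahedron ε) '' stdA 3 := by
      convert edge 0 1 (by decide) using 1; simp [tetrahedron]; module
    have hadd : ∀ i j, i ≠ j → ε i + ε j ∈ esbMap (tetrahedron ε) '' stdA 3 := by
      intro i j hij
      fin_cases i <;> fin_cases j <;>
        first | exact absurd rfl hij | assumption | (rw [add_comm]; assumption)
    have hsub : ∀ i j, i ≠ j → ε i - ε j ∈ esbMap (tetrahedron ε) '' stdA 3 := by
      intro i j hij
      fin_cases i <;> fin_cases j <;>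
        first | exact absurd rfl hij | assumption | (rw [← neg_sub]; apply neg_edge; assumption)
    rintro ⟨i, j, hij, rfl | rfl | rfl⟩
    · exact hadd i j hij
    · exact neg_edge _ (hadd i j hij)
    · exact hsub i j hij

lemma similarTo_stdA {k : ℝ} {ε : Fin 3 → V} (hε : IsFrame k ε) :
    SimilarTo (shortVectors ε) (stdA 3) := by
  refine SimilarTo.of_inner_map (esbMap (tetrahedron ε)) hε.pos ?_ (image_esbMap_tetrahedron ε)
  intro x hx y hy
  have expand : ∀ x : EuclideanSpace ℝ (Fin 4), esbMap (tetrahedron ε) x =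
      ((x 0 + x 1 - x 2 - x 3) / 2) • ε 0 + ((x 0 - x 1 + x 2 - x 3) / 2) • ε 1 +
        ((-x 0 + x 1 + x 2 - x 3) / 2) • ε 2 := by
    intro x
    simp [esbMap_apply, Fin.sum_univ_four, tetrahedron]
    module
  have hx0 := sum_eq_zero_of_mem_span_stdA hx
  have hy0 := sum_eq_zero_of_mem_span_stdA hy
  rw [Fin.sum_univ_four] at hx0 hy0
  have inner_coords : ∀ x y : EuclideanSpace ℝ (Fin 4),
      ⟪x, y⟫ = y 0 * x 0 + y 1 * x 1 + y 2 * x 2 + y 3 * x 3 := by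
    intro x y
    simp only [PiLp.inner_apply, RCLike.inner_apply, conj_trivial, Fin.sum_univ_four]
  rw [expand, expand, hε.inner_sum, show ⟪x, y⟫ = _ from inner_coords x y]
  linear_combination (-k / 4 * (y 0 + y 1 + y 2 + y 3)) * hx0

lemma IsRootSystem.inter_evenLattice_similarTo (hΦ : IsRootSystem Φ) {k : ℝ} {ε : Fin 3 → V}
    (hε : IsFrame k ε) (hS : HasShort Φ ε) :
    SimilarTo (Φ ∩ evenLattice ε) (stdA 3) ∨ SimilarTo (Φ ∩ evenLattice ε) (stdC 3) := by
  have hsub := hΦ.inter_evenLattice_subset hε hS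
  have hshort := hS.shortVectors_subset hΦ
  by_cases hlong : ∃ i, (2 : ℝ) • ε i ∈ Φ
  · right
    obtain ⟨i, hi⟩ := hlong
    have hall : ∀ j, (2 : ℝ) • ε j ∈ Φ := by
      intro j
      by_cases hij : i = j
      · exact hij ▸ hi
      convert hΦ.reflect_of_inner (hS i j hij).2 hi (c := 2) ?_ using 1
      · module
      · simp only [inner_sub_left, inner_sub_right, real_inner_smul_left, hε.inner_eq, hij,
          Ne.symm hij, if_true, if_false]
        ring
    have : Φ ∩ evenLattice ε = longVectors ε ∪ shortVectors ε := by
      refine hsub.antisymm (Set.union_subset ?_ hshort)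
      rintro _ ⟨j, rfl | rfl⟩
      · exact ⟨hall j, two_smul_mem_evenLattice ε j⟩
      · exact ⟨hΦ.neg_mem _ (hall j), AddSubgroup.neg_mem _ (two_smul_mem_evenLattice ε j)⟩
    exact this ▸ similarTo_stdC hε
  · left
    push Not at hlong
    have : Φ ∩ evenLattice ε = shortVectors ε := by
      refine Set.Subset.antisymm (fun v hv => (hsub hv).resolve_left ?_) hshort
      rintro ⟨i, rfl | rfl⟩
      · exact hlong i hv.1
      · exact hlong i (by simpa using hΦ.neg_mem _ hv.1)
    exact this ▸ similarTo_stdA hε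

end Frame

/-- **Statement 8.** Let `Φ` be an irreducible root system of rank at least 3, different
from `B_ℓ`, `C_ℓ` (and hence from `G₂`).  If `α, β, γ ∈ Φ` have equal length and
`α = β + γ`, then there are roots `β₁, γ₁ ∈ Φ∖(ℤβ + ℤγ)` of the same length as `β` with
`β₁ + γ₁ = β`; moreover `β, γ, β₁, γ₁` are contained in a closed symmetric root
subsystem `Φ₀ ⊆ Φ` of type `A₃` or `C₃`. -/
theorem statement8 {V : Type} [NormedAddCommGroup V] [InnerProductSpace ℝ V]
    {Φ : Set V} (hΦ : IsRootSystem Φ) (hirr : IsIrreducible Φ) (hrank : 3 ≤ rank Φ)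
    (hBC : ¬ IsTypeBC Φ)
    (α β γ : V) (hα : α ∈ Φ) (hβ : β ∈ Φ) (hγ : γ ∈ Φ)
    (hl1 : ‖α‖ = ‖β‖) (hl2 : ‖β‖ = ‖γ‖) (hsum : α = β + γ) :
    ∃ β₁ γ₁ : V, β₁ ∈ Φ ∧ γ₁ ∈ Φ ∧
      (¬ ∃ m n : ℤ, β₁ = m • β + n • γ) ∧ (¬ ∃ m n : ℤ, γ₁ = m • β + n • γ) ∧
      ‖β₁‖ = ‖β‖ ∧ ‖γ₁‖ = ‖β‖ ∧ β₁ + γ₁ = β ∧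
      ∃ Φ₀ : Set V, Φ₀ ⊆ Φ ∧ (∀ δ ∈ Φ₀, -δ ∈ Φ₀) ∧
        (∀ δ ∈ Φ₀, ∀ ε ∈ Φ₀, δ + ε ∈ Φ → δ + ε ∈ Φ₀) ∧
        β ∈ Φ₀ ∧ γ ∈ Φ₀ ∧ β₁ ∈ Φ₀ ∧ γ₁ ∈ Φ₀ ∧
        (SimilarTo Φ₀ (stdA 3) ∨ SimilarTo Φ₀ (stdC 3)) := by
  subst hsum
  have hpos := hΦ.inner_self_pos hβ
  obtain ⟨k, hββ⟩ : ∃ k, ⟪β, β⟫ = 2 * k := ⟨⟪β, β⟫ / 2, by ring⟩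
  have hγγ : ⟪γ, γ⟫ = 2 * k := by
    rw [← hββ, real_inner_self_eq_norm_sq, real_inner_self_eq_norm_sq, hl2]
  have hβγ : ⟪β, γ⟫ = -k := by
    have h : ⟪β + γ, β + γ⟫ = 2 * k := by
      rw [← hββ, real_inner_self_eq_norm_sq, real_inner_self_eq_norm_sq, hl1]
    rw [real_inner_add_add_self] at h
    linarith
  have hk : 0 < k := by linarith
  obtain ⟨a, ha, haP, haa, haβ, haγ⟩ := exists_adjacent_root hΦ hirr hrank hβ hγ hα hββ hγγ hβγ
  have hγβ : ⟪γ, β⟫ = -k := by rw [real_inner_comm, hβγ]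
  have hβa : ⟪β, a⟫ = k := by rw [real_inner_comm, haβ]
  have hγa : ⟪γ, a⟫ = 0 := by rw [real_inner_comm, haγ]
  have hb : β - a ∈ Φ := hΦ.sub_mem ha hβ (by linarith)
  have hβP : β ∈ Submodule.span ℝ {β, γ} := Submodule.subset_span (by simp)
  have hγP : γ ∈ Submodule.span ℝ {β, γ} := Submodule.subset_span (by simp)
  have not_int : ∀ v ∉ Submodule.span ℝ {β, γ}, ¬ ∃ m n : ℤ, v = m • β + n • γ := by
    rintro v hv ⟨m, n, rfl⟩
    exact hv (add_mem (zsmul_mem hβP m) (zsmul_mem hγP n))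
  have norm_eq : ∀ v : V, ⟪v, v⟫ = 2 * k → ‖v‖ = ‖β‖ := by
    intro v hv
    rw [← hββ, real_inner_self_eq_norm_sq, real_inner_self_eq_norm_sq] at hv
    exact (sq_eq_sq₀ (norm_nonneg _) (norm_nonneg _)).1 hv
  have hbb : ⟪β - a, β - a⟫ = 2 * k := by
    rw [real_inner_sub_sub_self]; linarith
  set ε : Fin 3 → V := ![β + (1 / 2 : ℝ) • (γ - a), (1 / 2 : ℝ) • (a + γ), (1 / 2 : ℝ) • (γ - a)]
    with hε_def
  have hε : IsFrame k ε := by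
    refine ⟨hk, fun i j => ?_⟩
    fin_cases i <;> fin_cases j <;>
      simp [hε_def, inner_add_left, inner_add_right, inner_sub_left, inner_sub_right,
        real_inner_smul_left, real_inner_smul_right,
        -inner_self_eq_norm_sq_to_K, hββ, hγγ, haa, hβγ, hγβ, haβ, hβa, haγ, hγa] <;> ring
  have s01 : ε 0 - ε 1 = β - a := by simp [hε_def]; module
  have s02 : ε 0 - ε 2 = β := by simp [hε_def]
  have s12 : ε 1 - ε 2 = a := by simp [hε_def]; module
  have a01 : ε 0 + ε 1 = β + γ := by simp [hε_def]; module
  have a02 : ε 0 + ε 2 = (β - a) + γ := by simp [hε_def]; module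
  have a12 : ε 1 + ε 2 = γ := by simp [hε_def]; module
  have hbγ : (β - a) + γ ∈ Φ := hΦ.add_mem hγ hb (by rw [inner_sub_left]; linarith)
  have hS : HasShort Φ ε := by
    have hadd : ∀ i j, i ≠ j → ε i + ε j ∈ Φ := by
      intro i j hij
      fin_cases i <;> fin_cases j <;> first
        | exact absurd rfl hij
        | simpa only [a01, a02, a12, Fin.reduceFinMk, Fin.zero_eta, Fin.mk_one]
        | (rw [add_comm]; simpa only [a01, a02, a12, Fin.reduceFinMk, Fin.zero_eta, Fin.mk_one])
    have hsub : ∀ i j, i ≠ j → ε i - ε j ∈ Φ := by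
      intro i j hij
      fin_cases i <;> fin_cases j <;> first
        | exact absurd rfl hij
        | simpa only [s01, s02, s12, Fin.reduceFinMk, Fin.zero_eta, Fin.mk_one]
        | (rw [← neg_sub]; apply hΦ.neg_mem
           simpa only [s01, s02, s12, Fin.reduceFinMk, Fin.zero_eta, Fin.mk_one])
    exact fun i j hij => ⟨hadd i j hij, hsub i j hij⟩
  refine ⟨a, β - a, ha, hb, not_int a haP, not_int _ fun h => haP ?_, norm_eq a haa,
    norm_eq _ hbb, by abel, Φ ∩ evenLattice ε, Set.inter_subset_left,
    fun δ hδ => ⟨hΦ.neg_mem δ hδ.1, neg_mem hδ.2⟩,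
    fun δ hδ η hη h => ⟨h, add_mem hδ.2 hη.2⟩, ⟨hβ, ?_⟩, ⟨hγ, ?_⟩, ⟨ha, ?_⟩, ⟨hb, ?_⟩,
    hΦ.inter_evenLattice_similarTo hε hS⟩
  · simpa using Submodule.sub_mem _ hβP h
  · exact s02 ▸ sub_mem_evenLattice ε 0 2
  · exact a12 ▸ add_mem_evenLattice ε 1 2
  · exact s12 ▸ sub_mem_evenLattice ε 1 2
  · exact s01 ▸ sub_mem_evenLattice ε 0 1

end Paper
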